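/- If d and e are two-free base-3/2 digit strings and j, k are natural numbers with v(d) + 2j = v(e) + 2k, then j = k and d = e; that is, the sets S_k = {v(d) + 2k : d a two-free base-3/2 digit string} are pairwise disjoint for distinct k. -/

import Mathlib

/-- The value of a base-3/2 digit string. -/
def val32 (d : ℕ →₀ ℕ) : ℚ := d.sum fun i c => (c : ℚ) * (3 / 2 : ℚ) ^ i

/-- A digit string is two-free if all of its digits are 0 or 1. -/
def TwoFree (d : ℕ →₀ ℕ) : Prop := ∀ i, d i ≤ 1

/-- The value of a digit string as a sum over an initial segment containing its support. -/
theorem val32_eq_sum_range (d : ℕ →₀ ℕ) {N : ℕ} (hN : d.support ⊆ Finset.range N) :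
    val32 d = ∑ i ∈ Finset.range N, (d i : ℚ) * (3 / 2 : ℚ) ^ i :=
  Finsupp.sum_of_support_subset d hN _ (by simp)

/-- A sum of integer multiples of `(3/2)^i`, `i < N`, becomes an even integer on
multiplication by `2^N`. -/
theorem exists_two_pow_mul_sum_eq_two_mul (f : ℕ → ℤ) (N : ℕ) :
    ∃ t : ℤ, (2 : ℚ) ^ N * ∑ i ∈ Finset.range N, (f i : ℚ) * (3 / 2 : ℚ) ^ i = 2 * t := by
  induction N with
  | zero => exact ⟨0, by simp⟩
  | succ N ih =>
    obtain ⟨t, ht⟩ := ih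
    refine ⟨2 * t + f N * 3 ^ N, ?_⟩
    have h2 : (2 : ℚ) ^ N * (3 / 2) ^ N = 3 ^ N := by rw [← mul_pow]; norm_num
    rw [Finset.sum_range_succ]
    push_cast
    linear_combination 2 * ht + 2 * (f N : ℚ) * h2

/-- An even integer has no nontrivial base-3/2 expansion with digits in `{-1, 0, 1}`. -/
theorem eq_zero_of_sum_eq_two_mul (f : ℕ → ℤ) (hf : ∀ i, |f i| ≤ 1) (m : ℤ) (N : ℕ)
    (h : ∑ i ∈ Finset.range N, (f i : ℚ) * (3 / 2 : ℚ) ^ i = 2 * m) :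
    m = 0 ∧ ∀ i < N, f i = 0 := by
  induction N with
  | zero => simpa [eq_comm] using h
  | succ N ih =>
    have hN : f N = 0 := by
      obtain ⟨t, ht⟩ := exists_two_pow_mul_sum_eq_two_mul f N
      have h2 : (2 : ℚ) ^ N * (3 / 2) ^ N = 3 ^ N := by rw [← mul_pow]; norm_num
      rw [Finset.sum_range_succ] at h
      have hq : (f N : ℚ) * 3 ^ N = 2 * (m * 2 ^ N - t) := by
        linear_combination (2 : ℚ) ^ N * h - ht - (f N : ℚ) * h2
      have hz : f N * 3 ^ N = 2 * (m * 2 ^ N - t) := by exact_mod_cast hq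
      have hdvd : (2 : ℤ) ∣ f N :=
        IsCoprime.dvd_of_dvd_mul_right (IsCoprime.pow_right (by norm_num)) ⟨_, hz⟩
      exact Int.eq_zero_of_abs_lt_dvd hdvd (by linarith [hf N])
    rw [Finset.sum_range_succ, hN, Int.cast_zero, zero_mul, add_zero] at h
    obtain ⟨hm, hlt⟩ := ih h
    refine ⟨hm, fun i hi => ?_⟩
    rcases Nat.lt_succ_iff_lt_or_eq.mp hi with hi | rfl
    exacts [hlt i hi, hN]

/-- The sets `S_k = {v(d) + 2k : d two-free}` are pairwise disjoint for
distinct `k`. -/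
theorem shifted_twoFree_sets_disjoint (d e : ℕ →₀ ℕ)
    (hd : TwoFree d) (he : TwoFree e) (j k : ℕ)
    (h : val32 d + 2 * j = val32 e + 2 * k) :
    j = k ∧ d = e := by
  obtain ⟨N, hN⟩ := Finset.exists_nat_subset_range (d.support ∪ e.support)
  have hdN := Finset.subset_union_left.trans hN
  have heN := Finset.subset_union_right.trans hN
  rw [val32_eq_sum_range d hdN, val32_eq_sum_range e heN] at h
  obtain ⟨hm, hf⟩ := eq_zero_of_sum_eq_two_mul (fun i => (d i : ℤ) - e i)
    (fun i => by have := hd i; have := he i; rw [abs_le]; omega) ((k : ℤ) - j) N (by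
      push_cast
      simp only [sub_mul, Finset.sum_sub_distrib]
      linear_combination h)
  refine ⟨by omega, Finsupp.ext fun i => ?_⟩
  by_cases hi : i < N
  · have := hf i hi
    omega
  · rw [Finsupp.notMem_support_iff.mp fun hs => hi (Finset.mem_range.mp (hdN hs)),
      Finsupp.notMem_support_iff.mp fun hs => hi (Finset.mem_range.mp (heN hs))]
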